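/- arXiv:1707.07116 — 5 statements merged into one kernel-verified Lean document; each statement's English description precedes it below -/
import Mathlib

section
/- Let (Ω, 𝒜, F) be a probability space, L : Ω → ℝ integrable, and ε ∈ (0,1). If there exists β ∈ ℝ such that β + ε⁻¹ · ∫ max(L(ω) − β, 0) dF(ω) ≤ 0, then F({ω : L(ω) > 0}) ≤ ε, i.e. F({ω : L(ω) ≤ 0}) ≥ 1 − ε. (In words: CVaR_ε(L) ≤ 0 implies that the chance constraint P_F(L ≤ 0) ≥ 1 − ε holds, so the CVaR constraint is a conservative approximation of the chance constraint.) -/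
open MeasureTheory

theorem stmt4 {Ω : Type*} [MeasurableSpace Ω] (F : Measure Ω) [IsProbabilityMeasure F]
    (L : Ω → ℝ) (hL : Integrable L F) (ε : ℝ) (hε : ε ∈ Set.Ioo (0 : ℝ) 1)
    (h : ∃ β : ℝ, β + ε⁻¹ * ∫ ω, max (L ω - β) 0 ∂F ≤ 0) :
    F {ω | 0 < L ω} ≤ ENNReal.ofReal ε ∧ F {ω | L ω ≤ 0} ≥ ENNReal.ofReal (1 - ε) := by
  obtain ⟨β, hβ⟩ := h
  have hε0 : 0 < ε := hε.1
  have hint : Integrable (fun ω => max (L ω - β) 0) F := (hL.sub (integrable_const β)).pos_part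
  have hnn : 0 ≤ fun ω => max (L ω - β) 0 := fun ω => le_max_right _ _
  have hI : 0 ≤ ∫ ω, max (L ω - β) 0 ∂F := integral_nonneg hnn
  have hIle : ∫ ω, max (L ω - β) 0 ∂F ≤ -β * ε := by
    have := mul_le_mul_of_nonneg_left hβ hε0.le
    rw [mul_add, mul_inv_cancel_left₀ hε0.ne'] at this
    linarith
  have hβ0 : β ≤ 0 := by
    by_contra! hpos
    nlinarith [mul_pos hpos hε0]
  have key : F.real {ω | 0 < L ω} ≤ ε := by
    rcases hβ0.lt_or_eq with hneg | rfl
    · have hmarkov := mul_meas_ge_le_integral_of_nonneg (ae_of_all F hnn) hint (-β)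
      have hsub : F.real {ω | 0 < L ω} ≤ F.real {ω | -β ≤ max (L ω - β) 0} :=
        measureReal_mono fun ω (hω : 0 < L ω) =>
          le_max_of_le_left (show -β ≤ L ω - β by linarith)
      exact hsub.trans (le_of_mul_le_mul_left (hmarkov.trans hIle) (neg_pos.2 hneg))
    · have hae := (integral_eq_zero_iff_of_nonneg hnn hint).1 (le_antisymm (by simpa using hIle) hI)
      have hzero : F {ω | 0 < L ω} = 0 := by
        have hle : ∀ᵐ ω ∂F, ¬ 0 < L ω := by
          filter_upwards [hae] with ω hω
          simpa using hω
        simpa [ae_iff] using hle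
      simpa [Measure.real, hzero] using hε0.le
  have hcompl : F.real {ω | L ω ≤ 0} = 1 - F.real {ω | 0 < L ω} := by
    rw [← probReal_compl_eq_one_sub₀ (nullMeasurableSet_lt aemeasurable_const hL.aemeasurable)]
    congr 1
    ext ω
    simp
  refine ⟨(ENNReal.le_ofReal_iff_toReal_le (measure_ne_top _ _) hε0.le).2 key, ?_⟩
  refine (ENNReal.ofReal_le_iff_le_toReal (measure_ne_top _ _)).2 ?_
  change 1 - ε ≤ F.real {ω | L ω ≤ 0}
  linarith
end

section
/- Let M ≥ 1, let y_1, …, y_M ∈ ℝ^Z, y_1^0, …, y_M^0 ∈ ℝ, γ_1, …, γ_M > 0, and ε ∈ (0,1). Let F be a probability measure on ℝ^Z under which each coordinate is integrable and the function ξ ↦ max_m γ_m·(y_mᵀξ + y_m^0) is integrable. If there exists β ∈ ℝ such that β + ε⁻¹ · ∫ max( max_{m} γ_m·(y_mᵀξ + y_m^0) − β, 0 ) dF(ξ) ≤ 0, then F({ξ ∈ ℝ^Z : y_mᵀξ + y_m^0 ≤ 0 for all m = 1,…,M}) ≥ 1 − ε. (The CVaR constraint applied to the scaled maximum is a conservative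 approximation of the joint chance constraint.) -/
open MeasureTheory Matrix

/-- The maximum of `f m` over all `m : Fin M`, for `M ≥ 1`. -/
noncomputable def maxOver {M : ℕ} (hM : 1 ≤ M) (f : Fin M → ℝ) : ℝ :=
  Finset.univ.sup' ⟨⟨0, hM⟩, Finset.mem_univ _⟩ f

theorem maxOver_le_iff {M : ℕ} (hM : 1 ≤ M) {f : Fin M → ℝ} {a : ℝ} :
    maxOver hM f ≤ a ↔ ∀ m, f m ≤ a :=
  (Finset.sup'_le_iff _ _).trans ⟨fun h m => h m (Finset.mem_univ m), fun h m _ => h m⟩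

/-- If the conditional value-at-risk of `X` at level `ε` is nonpositive, as witnessed by `β`, then
`X ≤ 0` with probability at least `1 - ε`. -/
theorem ofReal_one_sub_le_measure_nonpos_of_cvar_nonpos {Ω : Type*} [MeasurableSpace Ω]
    {μ : Measure Ω} [IsProbabilityMeasure μ] {X : Ω → ℝ} (hX : Integrable X μ) {ε β : ℝ}
    (hε : 0 < ε) (h : β + ε⁻¹ * ∫ ω, max (X ω - β) 0 ∂μ ≤ 0) :
    ENNReal.ofReal (1 - ε) ≤ μ {ω | X ω ≤ 0} := by
  have hnonneg : ∀ ω, 0 ≤ max (X ω - β) 0 := fun ω => le_max_right _ _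
  have hpos_int : Integrable (fun ω => max (X ω - β) 0) μ :=
    (hX.sub (integrable_const β)).pos_part
  have hI : 0 ≤ ∫ ω, max (X ω - β) 0 ∂μ := integral_nonneg hnonneg
  have hIle : ∫ ω, max (X ω - β) 0 ∂μ ≤ -β * ε := by
    rw [← div_le_iff₀ hε, div_eq_inv_mul]
    linarith
  have hβ : β ≤ 0 := by
    have := mul_nonneg (inv_nonneg.2 hε.le) hI
    linarith
  have hmeas : NullMeasurableSet {ω | X ω ≤ 0} μ :=
    nullMeasurableSet_le hX.aemeasurable aemeasurable_const
  have htail : μ.real {ω | X ω ≤ 0}ᶜ ≤ ε := by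
    rcases hβ.lt_or_eq with hβ | rfl
    · have hmarkov := mul_meas_ge_le_integral_of_nonneg
        (Filter.Eventually.of_forall hnonneg) hpos_int (-β)
      have hsub : μ.real {ω | X ω ≤ 0}ᶜ ≤ μ.real {ω | -β ≤ max (X ω - β) 0} := by
        refine measureReal_mono fun ω hω => ?_
        have hω : 0 < X ω := not_le.1 hω
        exact le_max_of_le_left (show -β ≤ X ω - β by linarith)
      exact hsub.trans (le_of_mul_le_mul_left (hmarkov.trans hIle) (neg_pos.2 hβ))
    · have hzero : ∫ ω, max (X ω - 0) 0 ∂μ = 0 := le_antisymm (by simpa using hIle) hI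
      have hae := (integral_eq_zero_iff_of_nonneg hnonneg hpos_int).1 hzero
      have hnull : μ {ω | X ω ≤ 0}ᶜ = 0 := by
        refine (ae_iff (p := fun ω => X ω ≤ 0)).1 ?_
        filter_upwards [hae] with ω hω
        simpa using hω
      simpa [measureReal_def, hnull] using hε.le
  refine ENNReal.ofReal_le_of_le_toReal ?_
  have hcompl := probReal_compl_eq_one_sub₀ hmeas
  change 1 - ε ≤ μ.real _
  linarith

theorem stmt5 (Z M : ℕ) (hM : 1 ≤ M) (y : Fin M → Fin Z → ℝ) (y0 : Fin M → ℝ)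
    (γ : Fin M → ℝ) (hγ : ∀ m, 0 < γ m) (ε : ℝ) (hε : ε ∈ Set.Ioo (0 : ℝ) 1)
    (F : Measure (Fin Z → ℝ)) [IsProbabilityMeasure F]
    (hcoord : ∀ z : Fin Z, Integrable (fun ξ : Fin Z → ℝ => ξ z) F)
    (hint : Integrable (fun ξ : Fin Z → ℝ => maxOver hM fun m => γ m * (y m ⬝ᵥ ξ + y0 m)) F)
    (h : ∃ β : ℝ,
      β + ε⁻¹ * ∫ ξ, max ((maxOver hM fun m => γ m * (y m ⬝ᵥ ξ + y0 m)) - β) 0 ∂F ≤ 0) :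
    F {ξ : Fin Z → ℝ | ∀ m, y m ⬝ᵥ ξ + y0 m ≤ 0} ≥ ENNReal.ofReal (1 - ε) := by
  obtain ⟨β, hβ⟩ := h
  have hset : {ξ : Fin Z → ℝ | ∀ m, y m ⬝ᵥ ξ + y0 m ≤ 0} =
      {ξ | (maxOver hM fun m => γ m * (y m ⬝ᵥ ξ + y0 m)) ≤ 0} := by
    ext ξ
    have hsign : ∀ m, γ m * (y m ⬝ᵥ ξ + y0 m) ≤ 0 ↔ y m ⬝ᵥ ξ + y0 m ≤ 0 := fun m =>
      ⟨fun h => nonpos_of_mul_nonpos_right h (hγ m),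
        mul_nonpos_of_nonneg_of_nonpos (hγ m).le⟩
    exact (forall_congr' hsign).symm.trans (maxOver_le_iff hM).symm
  rw [hset]
  exact ofReal_one_sub_le_measure_nonpos_of_cvar_nonpos hint hε.1 hβ
end

section
/- Let Z ∈ ℕ, l, u : Fin Z → ℝ with l z ≤ u z for all z, and let W_z be the associated support matrices. Let H be a symmetric real (Z+1)×(Z+1) matrix and τ : Fin Z → ℝ with τ z ≥ 0 for all z. If the matrix H + Σ_{z} (τ z)·W_z is positive semidefinite, then for every ξ ∈ Ξ (i.e. l z ≤ ξ z ≤ u z for all z), ξ̂ᵀ H ξ̂ ≥ 0, where ξ̂ = (ξ,1) is the homogenization of ξ. -/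
open Matrix

/-- The support matrix `W_z` associated with box bounds `l, u`. -/
noncomputable def suppW {Z : ℕ} (l u : Fin Z → ℝ) (z : Fin Z) :
    Matrix (Fin (Z + 1)) (Fin (Z + 1)) ℝ :=
  Matrix.of fun i j =>
    if i = Fin.castSucc z ∧ j = Fin.castSucc z then 1
    else if (i = Fin.castSucc z ∧ j = Fin.last Z) ∨ (i = Fin.last Z ∧ j = Fin.castSucc z) then
      -(l z + u z) / 2
    else if i = Fin.last Z ∧ j = Fin.last Z then l z * u z
    else 0

/-- The homogenization `ξ̂ = (ξ, 1)` of `ξ`. -/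
noncomputable def hom {Z : ℕ} (ξ : Fin Z → ℝ) : Fin (Z + 1) → ℝ := Fin.snoc ξ 1

/-- The quadratic form `ξ̂ᵀ A ξ̂` on homogenized vectors. -/
noncomputable def quadForm {Z : ℕ} (A : Matrix (Fin (Z + 1)) (Fin (Z + 1)) ℝ)
    (ξ : Fin Z → ℝ) : ℝ :=
  hom ξ ⬝ᵥ A.mulVec (hom ξ)

theorem suppW_mulVec_castSucc {Z : ℕ} (l u : Fin Z → ℝ) (z w : Fin Z) (ξ : Fin Z → ℝ) :
    (suppW l u z).mulVec (hom ξ) (Fin.castSucc w) =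
      if w = z then ξ z - (l z + u z) / 2 else 0 := by
  by_cases h : w = z
  · subst h
    simp [Matrix.mulVec, dotProduct, Fin.sum_univ_castSucc, suppW, hom, Fin.castSucc_ne_last,
      (Fin.castSucc_ne_last _).symm]
    ring
  · simp [Matrix.mulVec, dotProduct, suppW, h, Fin.castSucc_ne_last]

theorem suppW_mulVec_last {Z : ℕ} (l u : Fin Z → ℝ) (z : Fin Z) (ξ : Fin Z → ℝ) :
    (suppW l u z).mulVec (hom ξ) (Fin.last Z) = -(l z + u z) / 2 * ξ z + l z * u z := by
  simp [Matrix.mulVec, dotProduct, Fin.sum_univ_castSucc, suppW, hom, Fin.castSucc_ne_last,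
    (Fin.castSucc_ne_last _).symm]

theorem quadForm_suppW {Z : ℕ} (l u : Fin Z → ℝ) (z : Fin Z) (ξ : Fin Z → ℝ) :
    quadForm (suppW l u z) ξ = (ξ z - l z) * (ξ z - u z) := by
  simp only [quadForm, dotProduct, Fin.sum_univ_castSucc, suppW_mulVec_castSucc,
    suppW_mulVec_last]
  simp [hom]
  ring

theorem stmt7 (Z : ℕ) (l u : Fin Z → ℝ) (hlu : ∀ z, l z ≤ u z)
    (H : Matrix (Fin (Z + 1)) (Fin (Z + 1)) ℝ) (hH : H.IsSymm)
    (τ : Fin Z → ℝ) (hτ : ∀ z, 0 ≤ τ z)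
    (hpsd : (H + ∑ z : Fin Z, τ z • suppW l u z).PosSemidef) :
    ∀ ξ : Fin Z → ℝ, (∀ z, l z ≤ ξ z ∧ ξ z ≤ u z) → 0 ≤ quadForm H ξ := by
  intro ξ hξ
  have hnonneg : 0 ≤ quadForm (H + ∑ z : Fin Z, τ z • suppW l u z) ξ := by
    simpa [quadForm] using hpsd.dotProduct_mulVec_nonneg (hom ξ)
  have hsplit : quadForm (H + ∑ z : Fin Z, τ z • suppW l u z) ξ =
      quadForm H ξ + ∑ z : Fin Z, τ z * quadForm (suppW l u z) ξ := by
    simp [quadForm, Matrix.add_mulVec, Matrix.sum_mulVec, Matrix.smul_mulVec, dotProduct_add,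
      dotProduct_sum, dotProduct_smul]
  have hsum : ∑ z : Fin Z, τ z * quadForm (suppW l u z) ξ ≤ 0 :=
    Finset.sum_nonpos fun z _ => by
      rw [quadForm_suppW]
      exact mul_nonpos_of_nonneg_of_nonpos (hτ z) (mul_nonpos_of_nonneg_of_nonpos
        (sub_nonneg.2 (hξ z).1) (sub_nonpos.2 (hξ z).2))
  linarith
end

section
/- Let Z, M ∈ ℕ with M ≥ 1, let l, u : Fin Z → ℝ with l z ≤ u z, and let W_z be the associated support matrices. Let μ ∈ ℝ^Z, Σ ∈ ℝ^{Z×Z} symmetric, and B the moment matrix of (μ, Σ). Let H, β, y_m, y_m^0, γ_m > 0, and nonnegative τ_0, …, τ_M ∈ ℝ^Z satisfy the two positive-semidefiniteness conditions: H + Σ_z (τ_0)_z·W_z ⪰ 0 and, for each m, H + Σ_z (τ_m)_z·W_z − N_m ⪰ 0, where N_m is the symmetric matrix with zero top-left Z×Z block, last column/row (γ_m/2)·y_m and bottom-right entry γ_m·y_m^0 − β. Then for every probability measure F on ℝ^Z such that F(Ξ) = 1, each coordinate and each product of two coordinates is F-integrable, ∫ ξ dF = μ and ∫ ξξᵀ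 dF = Σ + μμᵀ, the function ξ ↦ max( max_m γ_m·(y_mᵀξ + y_m^0) − β, 0 ) is F-integrable and ∫ max( max_{m} γ_m·(y_mᵀξ + y_m^0) − β, 0 ) dF(ξ) ≤ Tr(B·H). -/
open MeasureTheory Matrix

/-- The symmetric matrix with zero top-left `Z×Z` block, last column/row equal to `v`
(on its first `Z` entries) and bottom-right entry `c`. -/
noncomputable def borderMat {Z : ℕ} (v : Fin Z → ℝ) (c : ℝ) :
    Matrix (Fin (Z + 1)) (Fin (Z + 1)) ℝ :=
  Matrix.of fun i j =>
    if hi : i = Fin.last Z then (if _hj : j = Fin.last Z then c else v (j.castPred _hj))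
    else if _hj : j = Fin.last Z then v (i.castPred hi)
    else 0

/-- The moment matrix `B = [[Σ + μμᵀ, μ], [μᵀ, 1]]` of `(μ, Σ)`. -/
noncomputable def momentMatrix {Z : ℕ} (μ : Fin Z → ℝ) (S : Matrix (Fin Z) (Fin Z) ℝ) :
    Matrix (Fin (Z + 1)) (Fin (Z + 1)) ℝ :=
  Matrix.of fun i j =>
    if hi : i = Fin.last Z then
      (if _hj : j = Fin.last Z then 1 else μ (j.castPred _hj))
    else if _hj : j = Fin.last Z then μ (i.castPred hi)
    else S (i.castPred hi) (j.castPred _hj) + μ (i.castPred hi) * μ (j.castPred _hj)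

/-- The homogenization `(ξ, 1)` of `ξ`. -/
def homogenize {Z : ℕ} (ξ : Fin Z → ℝ) : Fin (Z + 1) → ℝ :=
  Fin.snoc (α := fun _ => ℝ) ξ 1

@[simp]
lemma homogenize_castSucc {Z : ℕ} (ξ : Fin Z → ℝ) (z : Fin Z) :
    homogenize ξ z.castSucc = ξ z := by
  simp [homogenize]

@[simp]
lemma homogenize_last {Z : ℕ} (ξ : Fin Z → ℝ) : homogenize ξ (Fin.last Z) = 1 := by
  simp [homogenize]

lemma homogenize_dotProduct_suppW_mulVec {Z : ℕ} (l u ξ : Fin Z → ℝ) (z : Fin Z) :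
    homogenize ξ ⬝ᵥ suppW l u z *ᵥ homogenize ξ = (ξ z - l z) * (ξ z - u z) := by
  rw [dotProduct, Fin.sum_univ_castSucc, Finset.sum_eq_single z]
  · simp [dotProduct, mulVec, Fin.sum_univ_castSucc, suppW, Fin.castSucc_ne_last,
      (Fin.castSucc_ne_last _).symm]
    ring
  · intro x _ hx
    simp [dotProduct, mulVec, suppW, Fin.castSucc_ne_last, hx]
  · simp

lemma homogenize_dotProduct_borderMat_mulVec {Z : ℕ} (v ξ : Fin Z → ℝ) (c : ℝ) :
    homogenize ξ ⬝ᵥ borderMat v c *ᵥ homogenize ξ = 2 * (v ⬝ᵥ ξ) + c := by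
  simp [dotProduct, mulVec, Fin.sum_univ_castSucc, borderMat, Fin.castSucc_ne_last,
    mul_comm (ξ _)]
  ring

lemma quadraticForm_sum_smul_suppW_nonpos {Z : ℕ} {l u ξ τ : Fin Z → ℝ}
    (hξ : ∀ z, l z ≤ ξ z ∧ ξ z ≤ u z) (hτ : ∀ z, 0 ≤ τ z) :
    homogenize ξ ⬝ᵥ (∑ z, τ z • suppW l u z) *ᵥ homogenize ξ ≤ 0 := by
  simp only [sum_mulVec, dotProduct_sum, smul_mulVec, dotProduct_smul,
    homogenize_dotProduct_suppW_mulVec, smul_eq_mul]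
  exact Finset.sum_nonpos fun z _ => mul_nonpos_of_nonneg_of_nonpos (hτ z)
    (mul_nonpos_of_nonneg_of_nonpos (sub_nonneg.2 (hξ z).1) (sub_nonpos.2 (hξ z).2))

lemma integrable_homogenize_mul_homogenize {Z : ℕ} {F : Measure (Fin Z → ℝ)}
    [IsProbabilityMeasure F]
    (hcoord : ∀ z : Fin Z, Integrable (fun ξ : Fin Z → ℝ => ξ z) F)
    (hprod : ∀ z z' : Fin Z, Integrable (fun ξ : Fin Z → ℝ => ξ z * ξ z') F)
    (i j : Fin (Z + 1)) :
    Integrable (fun ξ => homogenize ξ i * homogenize ξ j) F := by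
  cases i using Fin.lastCases <;> cases j using Fin.lastCases <;> simp [hcoord, hprod]

lemma integral_homogenize_mul_homogenize {Z : ℕ} {F : Measure (Fin Z → ℝ)}
    [IsProbabilityMeasure F] {μ : Fin Z → ℝ} {S : Matrix (Fin Z) (Fin Z) ℝ}
    (hmean : ∀ z : Fin Z, ∫ ξ, ξ z ∂F = μ z)
    (hmom : ∀ z z' : Fin Z, ∫ ξ, ξ z * ξ z' ∂F = S z z' + μ z * μ z')
    (i j : Fin (Z + 1)) :
    ∫ ξ, homogenize ξ i * homogenize ξ j ∂F = momentMatrix μ S i j := by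
  cases i using Fin.lastCases <;> cases j using Fin.lastCases <;>
    simp [hmean, hmom, momentMatrix, Fin.castSucc_ne_last]

lemma homogenize_dotProduct_mulVec {Z : ℕ} (H : Matrix (Fin (Z + 1)) (Fin (Z + 1)) ℝ)
    (ξ : Fin Z → ℝ) :
    homogenize ξ ⬝ᵥ H *ᵥ homogenize ξ =
      ∑ i, ∑ j, homogenize ξ j * homogenize ξ i * H i j := by
  simp only [dotProduct, mulVec, Finset.mul_sum]
  exact Finset.sum_congr rfl fun i _ => Finset.sum_congr rfl fun j _ => by ring

lemma integrable_maxOver {M : ℕ} (hM : 1 ≤ M) {α : Type*} [MeasurableSpace α] {F : Measure α}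
    {f : Fin M → α → ℝ} (hf : ∀ m, Integrable (f m) F) :
    Integrable (fun x => maxOver hM fun m => f m x) F := by
  have h : (fun x => maxOver hM fun m => f m x) =
      Finset.univ.sup' ⟨⟨0, hM⟩, Finset.mem_univ _⟩ f := by
    ext x
    exact (Finset.sup'_apply _ f x).symm
  rw [h]
  exact Finset.sup'_induction (p := fun g => Integrable g F) _ f (fun _ h₁ _ h₂ => h₁.sup h₂) fun m _ => hf m

theorem stmt10 (Z M : ℕ) (hM : 1 ≤ M) (l u : Fin Z → ℝ) (hlu : ∀ z, l z ≤ u z)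
    (μ : Fin Z → ℝ) (S : Matrix (Fin Z) (Fin Z) ℝ) (hS : S.IsSymm)
    (H : Matrix (Fin (Z + 1)) (Fin (Z + 1)) ℝ) (hH : H.IsSymm) (β : ℝ)
    (y : Fin M → Fin Z → ℝ) (y0 : Fin M → ℝ) (γ : Fin M → ℝ) (hγ : ∀ m, 0 < γ m)
    (τ0 : Fin Z → ℝ) (hτ0 : ∀ z, 0 ≤ τ0 z)
    (τ : Fin M → Fin Z → ℝ) (hτ : ∀ m z, 0 ≤ τ m z)
    (hpsd0 : (H + ∑ z : Fin Z, τ0 z • suppW l u z).PosSemidef)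
    (hpsd : ∀ m : Fin M, (H + ∑ z : Fin Z, τ m z • suppW l u z -
      borderMat ((γ m / 2) • y m) (γ m * y0 m - β)).PosSemidef)
    (F : Measure (Fin Z → ℝ)) [IsProbabilityMeasure F]
    (hsupp : F {ξ : Fin Z → ℝ | ∀ z, l z ≤ ξ z ∧ ξ z ≤ u z} = 1)
    (hcoord : ∀ z : Fin Z, Integrable (fun ξ : Fin Z → ℝ => ξ z) F)
    (hprod : ∀ z z' : Fin Z, Integrable (fun ξ : Fin Z → ℝ => ξ z * ξ z') F)
    (hmean : ∀ z : Fin Z, ∫ ξ, ξ z ∂F = μ z)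
    (hmom : ∀ z z' : Fin Z, ∫ ξ, ξ z * ξ z' ∂F = S z z' + μ z * μ z') :
    Integrable
        (fun ξ : Fin Z → ℝ =>
          max ((maxOver hM fun m => γ m * (y m ⬝ᵥ ξ + y0 m)) - β) 0) F ∧
      ∫ ξ, max ((maxOver hM fun m => γ m * (y m ⬝ᵥ ξ + y0 m)) - β) 0 ∂F ≤
        (momentMatrix μ S * H).trace := by
  have hlin : ∀ m, Integrable (fun ξ : Fin Z → ℝ => γ m * (y m ⬝ᵥ ξ + y0 m)) F := fun m =>
    ((integrable_finsetSum _ fun z _ => (hcoord z).const_mul (y m z)).add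
      (integrable_const _)).const_mul _
  have hint : Integrable (fun ξ : Fin Z → ℝ =>
      max ((maxOver hM fun m => γ m * (y m ⬝ᵥ ξ + y0 m)) - β) 0) F :=
    ((integrable_maxOver hM hlin).sub (integrable_const β)).sup (integrable_zero _ _ _)
  refine ⟨hint, ?_⟩
  have hentry := integrable_homogenize_mul_homogenize hcoord hprod
  have htrace : ∫ ξ, homogenize ξ ⬝ᵥ H *ᵥ homogenize ξ ∂F = (momentMatrix μ S * H).trace := by
    simp only [homogenize_dotProduct_mulVec]
    refine (integral_finsetSum _ fun i _ =>
      integrable_finsetSum _ fun j _ => (hentry j i).mul_const (H i j)).trans ?_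
    refine (Finset.sum_congr rfl fun i _ => (integral_finsetSum _ fun j _ =>
      (hentry j i).mul_const (H i j))).trans ?_
    simp only [integral_mul_const, integral_homogenize_mul_homogenize hmean hmom, trace,
      diag_apply, mul_apply]
    exact Finset.sum_comm
  have hquad : Integrable (fun ξ => homogenize ξ ⬝ᵥ H *ᵥ homogenize ξ) F := by
    simp only [homogenize_dotProduct_mulVec]
    exact integrable_finsetSum _ fun i _ =>
      integrable_finsetSum _ fun j _ => (hentry j i).mul_const _
  have hbox : ∀ᵐ ξ ∂F, ∀ z, l z ≤ ξ z ∧ ξ z ≤ u z := by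
    refine (mem_ae_iff_prob_eq_one ?_).2 hsupp
    measurability
  rw [← htrace]
  refine integral_mono_ae hint hquad ?_
  filter_upwards [hbox] with ξ hξ
  refine max_le ?_ ?_
  · rw [sub_le_iff_le_add]
    refine Finset.sup'_le _ _ fun m _ => ?_
    have h := (hpsd m).dotProduct_mulVec_nonneg (homogenize ξ)
    have hW := quadraticForm_sum_smul_suppW_nonpos hξ (hτ m)
    simp only [star_trivial, sub_mulVec, add_mulVec, dotProduct_sub, dotProduct_add,
      homogenize_dotProduct_borderMat_mulVec, smul_dotProduct, smul_eq_mul] at h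
    linarith
  · have h := hpsd0.dotProduct_mulVec_nonneg (homogenize ξ)
    have hW := quadraticForm_sum_smul_suppW_nonpos hξ hτ0
    simp only [star_trivial, add_mulVec, dotProduct_add] at h
    linarith
end

section
/- Let M ≥ 1, let a_1, …, a_M : ℝ^Z → ℝ be measurable, γ_1, …, γ_M > 0, and ε ∈ (0,1). Let 𝒫 be any set of probability measures on ℝ^Z under each of which the function L(ξ) = max_{m} γ_m·a_m(ξ) is integrable. If for every F ∈ 𝒫 there exists β_F ∈ ℝ with β_F + ε⁻¹·∫ max(L(ξ) − β_F, 0) dF(ξ) ≤ 0 (in particular, if a single β works for all F ∈ 𝒫, as when the worst-case CVaR over 𝒫 is ≤ 0), then inf_{F ∈ 𝒫} F({ξ : a_m(ξ) ≤ 0 for all m = 1,…,M}) ≥ 1 − ε; i.e. the worst-case CVaR constraint is a conservative approximation of the distributionally robust joint chance constraint. -/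
open MeasureTheory

lemma maxOver_pos_iff {M : ℕ} (hM : 1 ≤ M) (f : Fin M → ℝ) :
    0 < maxOver hM f ↔ ∃ m, 0 < f m :=
  (Finset.lt_sup'_iff _).trans (by simp)

/-- If the conditional value-at-risk bound at level `ε` holds with some threshold `β`, then
the probability of a positive loss is at most `ε`. -/
lemma measureReal_pos_le_of_cvar_nonpos {Ω : Type*} [MeasurableSpace Ω] {μ : Measure Ω}
    [IsProbabilityMeasure μ] {X : Ω → ℝ} (hX : Integrable X μ) {ε β : ℝ} (hε : 0 < ε)
    (h : β + ε⁻¹ * ∫ ω, max (X ω - β) 0 ∂μ ≤ 0) :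
    μ.real {ω | 0 < X ω} ≤ ε := by
  have hint : Integrable (fun ω => max (X ω - β) 0) μ :=
    (hX.sub (integrable_const β)).pos_part
  have hnn : 0 ≤ fun ω => max (X ω - β) 0 := fun ω => le_max_right _ _
  have hI : 0 ≤ ∫ ω, max (X ω - β) 0 ∂μ := integral_nonneg hnn
  have hle : ∫ ω, max (X ω - β) 0 ∂μ ≤ ε * -β := by
    rw [← inv_mul_le_iff₀ hε]
    linarith
  have hβ : β ≤ 0 := by
    linarith [mul_nonneg (inv_nonneg.2 hε.le) hI]
  rcases hβ.lt_or_eq with hβ | rfl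
  · have hmarkov := mul_meas_ge_le_integral_of_nonneg (Filter.Eventually.of_forall hnn) hint (-β)
    have hmono : μ.real {ω | 0 < X ω} ≤ μ.real {ω | -β ≤ max (X ω - β) 0} := by
      refine measureReal_mono fun ω (hω : 0 < X ω) => ?_
      exact (show -β ≤ X ω - β by linarith).trans (le_max_left _ _)
    refine hmono.trans (le_of_mul_le_mul_left ?_ (neg_pos.2 hβ))
    linarith
  · have hzero : ∫ ω, max (X ω - 0) 0 ∂μ = 0 := le_antisymm (by simpa using hle) hI
    have hae := (integral_eq_zero_iff_of_nonneg hnn hint).1 hzero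
    have hnull : μ {ω | 0 < X ω} = 0 := by
      refine measure_mono_null (fun ω (hω : 0 < X ω) => ?_) (ae_iff.1 hae)
      simpa using hω
    simpa [measureReal_def, hnull] using hε.le

theorem stmt13 (Z M : ℕ) (hM : 1 ≤ M) (a : Fin M → (Fin Z → ℝ) → ℝ)
    (ha : ∀ m, Measurable (a m)) (γ : Fin M → ℝ) (hγ : ∀ m, 0 < γ m)
    (ε : ℝ) (hε : ε ∈ Set.Ioo (0 : ℝ) 1)
    (P : Set (Measure (Fin Z → ℝ)))
    (hP : ∀ F ∈ P, IsProbabilityMeasure F)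
    (hint : ∀ F ∈ P,
      Integrable (fun ξ : Fin Z → ℝ => maxOver hM fun m => γ m * a m ξ) F)
    (h : ∀ F ∈ P, ∃ β : ℝ,
      β + ε⁻¹ * ∫ ξ, max ((maxOver hM fun m => γ m * a m ξ) - β) 0 ∂F ≤ 0) :
    (⨅ F ∈ P, F {ξ : Fin Z → ℝ | ∀ m, a m ξ ≤ 0}) ≥ ENNReal.ofReal (1 - ε) := by
  refine le_iInf₂ fun F hF => ?_
  have := hP F hF
  obtain ⟨β, hβ⟩ := h F hF
  have hpos := measureReal_pos_le_of_cvar_nonpos (hint F hF) hε.1 hβ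
  have hset : {ξ : Fin Z → ℝ | ∀ m, a m ξ ≤ 0}ᶜ =
      {ξ | 0 < maxOver hM fun m => γ m * a m ξ} := by
    ext ξ
    simp only [Set.mem_compl_iff, Set.mem_ofPred_eq, not_forall, not_le,
      maxOver_pos_iff, mul_pos_iff_of_pos_left (hγ _)]
  have hmeas : MeasurableSet {ξ : Fin Z → ℝ | ∀ m, a m ξ ≤ 0} := by
    rw [Set.ofPred_forall]
    exact MeasurableSet.iInter fun m => measurableSet_le (ha m) measurable_const
  rw [← hset, probReal_compl_eq_one_sub hmeas] at hpos
  rw [← ofReal_measureReal]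
  exact ENNReal.ofReal_le_ofReal (by linarith)
end
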